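/- There exists a real constant C > 0 such that for every positive integer ℓ and every integer n with n ≥ ℓ⁴/2 + C·ℓ³, every partial Mendelsohn triple system on a point set of cardinality n has an ℓ-good (non-cyclic) sequencing. -/

import Mathlib

/-- The three ordered pairs contained in a 3-cycle `(x,y,z)`. -/
def cycPairs {V : Type} (t : V × V × V) : Set (V × V) :=
  {(t.1, t.2.1), (t.2.1, t.2.2), (t.2.2, t.1)}

/-- `t'` is a cyclic rotation of the 3-cycle `t`. -/
def cycRot {V : Type} (t t' : V × V × V) : Prop :=
  t' = t ∨ t' = (t.2.1, t.2.2, t.1) ∨ t' = (t.2.2, t.1, t.2.1)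

/-- A ternary relation modelling a set of cyclic triples on `V` in which two cyclically
consecutive entries determine the third. -/
structure IsCyclicPartial {V : Type*} (T : V → V → V → Prop) : Prop where
  rotate : ∀ {a b c}, T a b c → T b c a
  ne : ∀ {a b c}, T a b c → a ≠ b
  unique : ∀ {a b c d}, T a b c → T a b d → c = d

/-- Two positions are near if they lie in a common segment of length `ℓ`. -/
def Near (ℓ p q : ℕ) : Prop := p < q + ℓ ∧ q < p + ℓ

/-- No triple of `T` occurs, in any order, among pairwise near positions of `P`. -/
def TripleFree {V : Type*} (T : V → V → V → Prop) (ℓ : ℕ) (f : ℕ → V) (P : Finset ℕ) : Prop :=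
  ∀ p ∈ P, ∀ q ∈ P, ∀ r ∈ P, Near ℓ p q → Near ℓ q r → Near ℓ r p → ¬ T (f p) (f q) (f r)

/-- The value `v` completes a triple of `T` with the values at two positions of `P` near `p`. -/
def Blocked {V : Type*} (T : V → V → V → Prop) (ℓ : ℕ) (f : ℕ → V) (P : Finset ℕ)
    (p : ℕ) (v : V) : Prop :=
  ∃ q ∈ P, ∃ r ∈ P, Near ℓ p q ∧ Near ℓ p r ∧ T (f q) (f r) v

theorem Near.symm {ℓ p q : ℕ} (h : Near ℓ p q) : Near ℓ q p := ⟨h.2, h.1⟩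

theorem Blocked.mono {V : Type*} {T : V → V → V → Prop} {ℓ : ℕ} {f g : ℕ → V} {P Q : Finset ℕ}
    {p : ℕ} {v : V} (h : Blocked T ℓ f P p v) (hPQ : ∀ q ∈ P, Near ℓ p q → q ∈ Q)
    (hfg : ∀ q ∈ Q, f q = g q) : Blocked T ℓ g Q p v := by
  obtain ⟨q, hq, r, hr, hpq, hpr, ht⟩ := h
  have hq' := hPQ q hq hpq
  have hr' := hPQ r hr hpr
  exact ⟨q, hq', r, hr', hpq, hpr, hfg q hq' ▸ hfg r hr' ▸ ht⟩

theorem TripleFree.congr {V : Type*} {T : V → V → V → Prop} {ℓ : ℕ} {f g : ℕ → V} {P : Finset ℕ}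
    (h : TripleFree T ℓ f P) (hfg : ∀ q ∈ P, g q = f q) : TripleFree T ℓ g P := by
  intro p hp q hq r hr
  rw [hfg p hp, hfg q hq, hfg r hr]
  exact h p hp q hq r hr

open Classical in
theorem card_blocked_le {V : Type*} [Fintype V] {T : V → V → V → Prop} {ℓ : ℕ}
    (hT : IsCyclicPartial T) (f : ℕ → V) (P : Finset ℕ) (p : ℕ) :
    (Finset.univ.filter (Blocked T ℓ f P p)).card ≤ 4 * ℓ ^ 2 := by
  rcases isEmpty_or_nonempty V with hV | ⟨⟨v₀⟩⟩
  · simp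
  let N := Finset.Ico (p + 1 - ℓ) (p + ℓ)
  let third : ℕ × ℕ → V := fun x =>
    if h : ∃ v, T (f x.1) (f x.2) v then h.choose else v₀
  have hsub : Finset.univ.filter (Blocked T ℓ f P p) ⊆ (N ×ˢ N).image third := by
    intro v hv
    obtain ⟨q, -, r, -, hq, hr, ht⟩ := (Finset.mem_filter.mp hv).2
    refine Finset.mem_image.mpr ⟨(q, r), ?_, ?_⟩
    · simp only [N, Finset.mem_product, Finset.mem_Ico]
      unfold Near at hq hr
      omega
    · have h : ∃ v, T (f q) (f r) v := ⟨v, ht⟩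
      simp only [third, dif_pos h]
      exact hT.unique h.choose_spec ht
  have hN : N.card ≤ 2 * ℓ := by
    simp only [N, Nat.card_Ico]
    omega
  calc _ ≤ ((N ×ˢ N).image third).card := Finset.card_le_card hsub
    _ ≤ N.card * N.card := Finset.card_image_le.trans_eq (Finset.card_product _ _)
    _ ≤ (2 * ℓ) * (2 * ℓ) := Nat.mul_le_mul hN hN
    _ = 4 * ℓ ^ 2 := by ring

theorem TripleFree.union {V : Type*} {T : V → V → V → Prop} {ℓ : ℕ}
    (hT : IsCyclicPartial T) {f : ℕ → V} {P Q : Finset ℕ}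
    (hP : TripleFree T ℓ f P) (hfar : ∀ p ∈ Q, ∀ q ∈ Q, p ≠ q → ¬ Near ℓ p q)
    (hQ : ∀ q ∈ Q, ¬ Blocked T ℓ f P q (f q)) : TripleFree T ℓ f (P ∪ Q) := by
  have irrefl : ∀ {a b}, ¬ T a a b := fun h => hT.ne h rfl
  have key : ∀ p ∈ Q, ∀ q ∈ P ∪ Q, ∀ r ∈ P ∪ Q, Near ℓ p q → Near ℓ q r → Near ℓ r p →
      ¬ T (f p) (f q) (f r) := by
    intro p hp q hq r hr hpq hqr hrp ht
    by_cases hpq' : p = q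
    · exact irrefl (hpq' ▸ ht)
    by_cases hpr' : r = p
    · exact hT.ne (hT.rotate (hT.rotate ht)) (congrArg f hpr')
    rcases Finset.mem_union.mp hq with hq | hq
    · rcases Finset.mem_union.mp hr with hr | hr
      · exact hQ p hp ⟨q, hq, r, hr, hpq, hrp.symm, hT.rotate ht⟩
      · exact hfar r hr p hp hpr' hrp
    · exact hfar p hp q hq hpq' hpq
  intro p hp q hq r hr hpq hqr hrp ht
  rcases Finset.mem_union.mp hp with hp' | hp'
  · rcases Finset.mem_union.mp hq with hq' | hq'
    · rcases Finset.mem_union.mp hr with hr' | hr'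
      · exact hP p hp' q hq' r hr' hpq hqr hrp ht
      · exact key r hr' p hp q hq hrp hpq hqr (hT.rotate (hT.rotate ht))
    · exact key q hq' r hr p hp hqr hrp hpq (hT.rotate ht)
  · exact key p hp' q hq r hr hpq hqr hrp ht

/-- Values for isolated new positions `Q` that are fresh and unblocked extend a triple-free
assignment. -/
theorem exists_extend_isolated {V : Type*} {T : V → V → V → Prop} {ℓ : ℕ}
    (hT : IsCyclicPartial T) {f g : ℕ → V} {P Q : Finset ℕ}
    (hf : Set.InjOn f P) (hP : TripleFree T ℓ f P) (hPQ : Disjoint P Q)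
    (hfar : ∀ p ∈ Q, ∀ q ∈ Q, p ≠ q → ¬ Near ℓ p q) (hg : Set.InjOn g Q)
    (hfg : ∀ p ∈ P, ∀ q ∈ Q, f p ≠ g q) (hQ : ∀ q ∈ Q, ¬ Blocked T ℓ f P q (g q)) :
    ∃ h : ℕ → V, (∀ p ∈ P, h p = f p) ∧ (∀ q ∈ Q, h q = g q) ∧
      Set.InjOn h ↑(P ∪ Q) ∧ TripleFree T ℓ h (P ∪ Q) := by
  let h : ℕ → V := fun x => if x ∈ Q then g x else f x
  have hhP : ∀ p ∈ P, h p = f p := fun p hp => if_neg (Finset.disjoint_left.mp hPQ hp)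
  have hhQ : ∀ q ∈ Q, h q = g q := fun q hq => if_pos hq
  refine ⟨h, hhP, hhQ, ?_, ?_⟩
  · intro x hx y hy hxy
    rcases Finset.mem_union.mp (Finset.mem_coe.mp hx) with hx | hx <;>
      rcases Finset.mem_union.mp (Finset.mem_coe.mp hy) with hy | hy
    · exact hf hx hy (by rwa [hhP x hx, hhP y hy] at hxy)
    · exact absurd (by rwa [hhP x hx, hhQ y hy] at hxy) (hfg x hx y hy)
    · exact absurd (by rw [hhQ x hx, hhP y hy] at hxy; exact hxy.symm) (hfg y hy x hx)
    · exact hg hx hy (by rwa [hhQ x hx, hhQ y hy] at hxy)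
  · refine (hP.congr hhP).union hT hfar fun q hq hb => hQ q hq ?_
    rw [hhQ q hq] at hb
    exact hb.mono (fun q hq _ => hq) hhP

/-- Greedy extension: further positions can be filled while enough values remain. -/
theorem exists_extend_greedy {V : Type*} [Fintype V] {T : V → V → V → Prop} {ℓ : ℕ}
    (hT : IsCyclicPartial T) {f : ℕ → V} {P : Finset ℕ}
    (hf : Set.InjOn f P) (hP : TripleFree T ℓ f P) (Q : Finset ℕ) (hPQ : Disjoint P Q)
    (hcard : P.card + Q.card + 4 * ℓ ^ 2 ≤ Fintype.card V) :
    ∃ h : ℕ → V, (∀ p ∈ P, h p = f p) ∧ Set.InjOn h ↑(P ∪ Q) ∧ TripleFree T ℓ h (P ∪ Q) := by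
  classical
  induction Q using Finset.induction_on with
  | empty => exact ⟨f, fun _ _ => rfl, by simpa using hf, by simpa using hP⟩
  | insert x Q hx ih =>
    rw [Finset.card_insert_of_notMem hx] at hcard
    rw [Finset.disjoint_insert_right] at hPQ
    obtain ⟨h, hh, hinj, hfree⟩ := ih hPQ.2 (by omega)
    let B := (P ∪ Q).image h ∪ Finset.univ.filter (Blocked T ℓ h (P ∪ Q) x)
    have hB : B.card < Fintype.card V := by
      have h1 := Finset.card_union_le ((P ∪ Q).image h)
        (Finset.univ.filter (Blocked T ℓ h (P ∪ Q) x))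
      have h2 : ((P ∪ Q).image h).card ≤ _ := Finset.card_image_le
      have h3 := Finset.card_union_le P Q
      have h4 := card_blocked_le (ℓ := ℓ) hT h (P ∪ Q) x
      simp only [B]
      omega
    obtain ⟨v, hv⟩ : ∃ v, v ∉ B := by
      by_contra! hall
      exact hB.ne (Finset.card_eq_iff_eq_univ B |>.mpr (Finset.eq_univ_iff_forall.mpr hall))
    simp only [B, Finset.mem_union, not_or, Finset.mem_image, not_exists, not_and,
      Finset.mem_filter, Finset.mem_univ, true_and] at hv
    obtain ⟨k, hk, -, hkinj, hkfree⟩ := exists_extend_isolated (Q := {x}) (g := fun _ => v) hT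
      hinj hfree (by simp [hPQ.1, hx]) (by simp +contextual) (by simp)
      (fun p hp _ _ => hv.1 p (Finset.mem_union.mp hp)) (by simpa using hv.2)
    have hset : P ∪ insert x Q = P ∪ Q ∪ {x} := by
      ext y
      simp only [Finset.mem_union, Finset.mem_insert, Finset.mem_singleton]
      tauto
    refine ⟨k, fun p hp => ?_, hset ▸ hkinj, hset ▸ hkfree⟩
    rw [hk p (Finset.mem_union_left _ hp), hh p hp]

open Classical in
/-- If each of the positions of `H` rejects at most `d` values, then at most `2 * d` values are
rejected by more than half of `H`. -/
theorem card_often_rejected_le {α V : Type*} [Fintype V] (R : α → V → Prop) (H : Finset α) (d : ℕ)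
    (hd : ∀ h ∈ H, (Finset.univ.filter (R h)).card ≤ d) :
    (Finset.univ.filter fun v => H.card < 2 * (H.filter fun h => R h v).card).card ≤ 2 * d := by
  set D := Finset.univ.filter fun v => H.card < 2 * (H.filter fun h => R h v).card with hD
  rcases H.eq_empty_or_nonempty with rfl | hne
  · simp [hD]
  have h1 : ∑ v ∈ D, (H.filter fun h => R h v).card ≤ H.card * d := by
    calc _ = ∑ h ∈ H, (D.filter fun v => R h v).card :=
          (Finset.sum_card_bipartiteAbove_eq_sum_card_bipartiteBelow (fun h v => R h v)).symm
      _ ≤ ∑ _h ∈ H, d := Finset.sum_le_sum fun h hh => (Finset.card_le_card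
          (Finset.filter_subset_filter _ (Finset.subset_univ _))).trans (hd h hh)
      _ = H.card * d := by simp
  have h2 : D.card * H.card ≤ 2 * ∑ v ∈ D, (H.filter fun h => R h v).card := by
    rw [Finset.mul_sum, ← smul_eq_mul, ← Finset.sum_const]
    exact Finset.sum_le_sum fun v hv => (Finset.mem_filter.mp hv).2.le
  refine Nat.le_of_mul_le_mul_right (c := H.card) ?_ hne.card_pos
  calc _ ≤ 2 * (H.card * d) := h2.trans (Nat.mul_le_mul_left 2 h1)
    _ = _ := by ring

open Classical in
/-- A system of distinct representatives when both sides of the rejection relation have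
at most half of the opposite side as neighbours. -/
theorem exists_injective_not_rejected {α V : Type*} (R : α → V → Prop) (H : Finset α) (S : Finset V)
    (hcard : H.card = S.card) (hH : ∀ h ∈ H, 2 * (S.filter (R h)).card ≤ S.card)
    (hS : ∀ v ∈ S, 2 * (H.filter fun h => R h v).card ≤ H.card) :
    ∃ g : H → V, Function.Injective g ∧ ∀ h : H, g h ∈ S ∧ ¬ R h (g h) := by
  have hall := (Finset.all_card_le_biUnion_card_iff_exists_injective
    (fun h : H => S.filter fun v => ¬ R h v)).mp ?_
  · obtain ⟨g, hg, hmem⟩ := hall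
    exact ⟨g, hg, fun h => by simpa using hmem h⟩
  intro A
  rcases A.eq_empty_or_nonempty with rfl | ⟨a, ha⟩
  · simp
  by_cases hA : 2 * A.card ≤ S.card
  · have h1 := Finset.card_filter_add_card_filter_not (s := S) (R a)
    have h2 := hH a a.2
    have h3 : (S.filter fun v => ¬ R a v).card ≤ _ :=
      Finset.card_le_card (Finset.subset_biUnion_of_mem (fun h : H => S.filter fun v => ¬ R h v) ha)
    omega
  · have hsub : S ⊆ A.biUnion fun h : H => S.filter fun v => ¬ R h v := by
      intro v hv
      by_contra hcon
      have hR : ∀ h ∈ A, R h v := by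
        intro h hh
        by_contra hr
        exact hcon (Finset.mem_biUnion.mpr ⟨h, hh, Finset.mem_filter.mpr ⟨hv, hr⟩⟩)
      have hle : (A.map (Function.Embedding.subtype _)).card ≤
          (H.filter fun h => R h v).card := by
        refine Finset.card_le_card fun x hx => ?_
        obtain ⟨h, hh, rfl⟩ := Finset.mem_map.mp hx
        exact Finset.mem_filter.mpr ⟨h.2, hR h hh⟩
      rw [Finset.card_map] at hle
      have := hS v hv
      omega
    have h1 := Finset.card_le_card hsub
    have h2 := A.card_le_univ
    rw [Fintype.card_coe] at h2
    omega

/-- Widely spaced positions `ℓ + 2 * ℓ * j` are pairwise not near. -/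
theorem not_near_spaced {ℓ i j : ℕ} (h : i ≠ j) : ¬ Near ℓ (ℓ + 2 * ℓ * i) (ℓ + 2 * ℓ * j) := by
  rintro ⟨h1, h2⟩
  rcases Nat.lt_or_gt_of_ne h with h | h <;> nlinarith

theorem exists_tripleFree {V : Type*} [Fintype V] {T : V → V → V → Prop} {ℓ : ℕ}
    (hT : IsCyclicPartial T) (hℓ : 0 < ℓ)
    (hn : 32 * ℓ ^ 3 ≤ Fintype.card V) :
    ∃ f : ℕ → V, Set.InjOn f ↑(Finset.range (Fintype.card V)) ∧
      TripleFree T ℓ f (Finset.range (Fintype.card V)) := by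
  classical
  set n := Fintype.card V
  have hℓ3 : 0 < ℓ ^ 3 := by positivity
  have hℓ2 : ℓ ^ 2 ≤ ℓ ^ 3 := Nat.pow_le_pow_right hℓ (by norm_num)
  have hV : Nonempty V := Fintype.card_pos_iff.mp (by omega)
  let K := 8 * ℓ ^ 2
  let s : ℕ → ℕ := fun j => ℓ + 2 * ℓ * j
  have hs : Function.Injective s := fun i j hij => by
    by_contra hne
    simp only [s] at hij
    exact not_near_spaced (ℓ := ℓ) hne ⟨by omega, by omega⟩
  have hKℓ : 2 * ℓ * K = 16 * ℓ ^ 3 := by simp only [K]; ring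
  have hfar : ∀ A : Finset ℕ, ∀ p ∈ A.image s, ∀ q ∈ A.image s, p ≠ q → ¬ Near ℓ p q := by
    intro A p hp q hq hpq
    obtain ⟨i, -, rfl⟩ := Finset.mem_image.mp hp
    obtain ⟨j, -, rfl⟩ := Finset.mem_image.mp hq
    exact not_near_spaced fun h => hpq (congrArg s h)
  -- The holes, and the zone consisting of all positions near some hole.
  let H := (Finset.range K).image s
  have hHcard : H.card = K := by
    rw [Finset.card_image_of_injective _ hs, Finset.card_range]
  have hHlt : ∀ h ∈ H, ℓ ≤ h ∧ h + ℓ ≤ 2 * ℓ * K := by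
    intro h hh
    obtain ⟨j, hj, rfl⟩ := Finset.mem_image.mp hh
    rw [Finset.mem_range] at hj
    simp only [s]
    constructor <;> nlinarith
  let Z := Finset.range (2 * ℓ * K) \ H
  obtain ⟨f₀, -, hf₀, hfree₀⟩ := exists_extend_greedy (ℓ := ℓ) (f := fun _ => hV.some)
    (P := ∅) hT (by simp) (by intro p hp; simp at hp) Z (by simp) (by
      have h : Z.card ≤ (Finset.range (2 * ℓ * K)).card := Finset.card_le_card Finset.sdiff_subset
      rw [Finset.card_range] at h
      rw [Finset.card_empty]
      omega)
  rw [Finset.empty_union] at hf₀ hfree₀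
  -- Values blocked at more than half of the holes are placed at isolated positions outside the zone.
  let D' := Finset.univ.filter fun v => H.card < 2 * (H.filter fun h => Blocked T ℓ f₀ Z h v).card
  let D := D' \ Z.image f₀
  have hDcard : D.card ≤ K := by
    have h1 : D'.card ≤ 2 * (4 * ℓ ^ 2) :=
      card_often_rejected_le (fun h v => Blocked T ℓ f₀ Z h v) H (4 * ℓ ^ 2)
        fun h _ => card_blocked_le hT f₀ Z h
    have h2 : D.card ≤ D'.card := Finset.card_le_card Finset.sdiff_subset
    simp only [K]
    omega
  let Y := (Finset.Ico K (K + D.card)).image s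
  have hYcard : Y.card = D.card := by
    rw [Finset.card_image_of_injective _ hs, Nat.card_Ico]
    omega
  have hYbd : ∀ y ∈ Y, ℓ + 2 * ℓ * K ≤ y ∧ y < 4 * ℓ * K := by
    intro y hy
    obtain ⟨j, hj, rfl⟩ := Finset.mem_image.mp hy
    rw [Finset.mem_Ico] at hj
    simp only [s]
    constructor <;> nlinarith
  have hZlt : ∀ z ∈ Z, z < 2 * ℓ * K := fun z hz =>
    Finset.mem_range.mp (Finset.mem_sdiff.mp hz).1
  obtain ⟨g₀, hg₀⟩ : ∃ g : ℕ → V, Set.BijOn g Y D :=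
    Y.finite_toSet.exists_bijOn_of_encard_eq (by simp [hYcard])
  obtain ⟨f₁, hf₁Z, hf₁Y, hf₁, hfree₁⟩ := exists_extend_isolated (Q := Y) (g := g₀) hT hf₀ hfree₀
    (Finset.disjoint_left.mpr fun z hz hy => by
      have := hZlt z hz
      have := hYbd z hy
      omega)
    (hfar _) hg₀.injOn
    (fun p hp q hq h => (Finset.mem_sdiff.mp (hg₀.mapsTo hq)).2
      (h ▸ Finset.mem_image_of_mem f₀ hp))
    (fun y hy => by
      rintro ⟨z, hz, -, -, hyz, -⟩
      have := hZlt z hz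
      have := hYbd y hy
      have := hyz.1
      omega)
  -- All positions other than the holes are filled.
  let P := Finset.range n \ H
  have hHn : H ⊆ Finset.range n := fun h hh => by
    have := hHlt h hh
    rw [Finset.mem_range]
    omega
  have hZYP : Z ∪ Y ⊆ P := by
    intro x hx
    rcases Finset.mem_union.mp hx with hx | hx
    · have := hZlt x hx
      exact Finset.mem_sdiff.mpr
        ⟨Finset.mem_range.mpr (by omega), (Finset.mem_sdiff.mp hx).2⟩
    · have hb := hYbd x hx
      refine Finset.mem_sdiff.mpr ⟨Finset.mem_range.mpr ?_, fun hxH => ?_⟩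
      · nlinarith
      · have := hHlt x hxH
        omega
  have hPcard : P.card + K = n := by
    have := Finset.card_sdiff_add_card_eq_card hHn
    rwa [hHcard, Finset.card_range] at this
  obtain ⟨f₂, hf₂, hinj₂, hfree₂⟩ := exists_extend_greedy hT hf₁ hfree₁ (P \ (Z ∪ Y))
    Finset.disjoint_sdiff (by
      have := Finset.card_sdiff_add_card_eq_card hZYP
      simp only [K] at hPcard
      omega)
  rw [Finset.union_sdiff_of_subset hZYP] at hinj₂ hfree₂
  have hf₂Z : ∀ z ∈ Z, f₂ z = f₀ z := fun z hz => by
    rw [hf₂ z (Finset.mem_union_left _ hz), hf₁Z z hz]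
  have hblocked : ∀ h ∈ H, ∀ v, Blocked T ℓ f₂ P h v → Blocked T ℓ f₀ Z h v := by
    intro h hh v hb
    refine hb.mono (fun q hq hnear => Finset.mem_sdiff.mpr ⟨?_, (Finset.mem_sdiff.mp hq).2⟩) hf₂Z
    have := hHlt h hh
    have := hnear.2
    rw [Finset.mem_range]
    omega
  -- The remaining values are matched with the holes.
  let S := Finset.univ \ P.image f₂
  have hScard : S.card = K := by
    have h1 := Finset.card_sdiff_add_card_eq_card (Finset.subset_univ (P.image f₂))
    rw [Finset.card_image_of_injOn hinj₂, Finset.card_univ] at h1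
    simp only [S]
    omega
  obtain ⟨g, hg, hgS⟩ := exists_injective_not_rejected (fun h v => Blocked T ℓ f₂ P h v) H S
    (hHcard.trans hScard.symm)
    (fun h _ => by
      have h1 : (S.filter (Blocked T ℓ f₂ P h)).card ≤ _ :=
        Finset.card_le_card (Finset.filter_subset_filter _ (Finset.subset_univ S))
      have h2 := h1.trans (card_blocked_le (ℓ := ℓ) hT f₂ P h)
      rw [hScard]
      calc 2 * _ ≤ 2 * (4 * ℓ ^ 2) := Nat.mul_le_mul_left 2 (by convert h2)
        _ = K := by simp only [K]; ring)
    (fun v hv => by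
      have hvP : v ∉ P.image f₂ := (Finset.mem_sdiff.mp hv).2
      have hvZ : v ∉ Z.image f₀ := fun hvZ => by
        obtain ⟨z, hz, rfl⟩ := Finset.mem_image.mp hvZ
        exact hvP (Finset.mem_image.mpr ⟨z, hZYP (Finset.mem_union_left _ hz), hf₂Z z hz⟩)
      have hvD : v ∉ D := fun hvD => by
        obtain ⟨y, hy, rfl⟩ := hg₀.surjOn hvD
        refine hvP (Finset.mem_image.mpr ⟨y, hZYP (Finset.mem_union_right _ hy), ?_⟩)
        rw [hf₂ y (Finset.mem_union_right _ hy), hf₁Y y hy]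
      have hvD' : v ∉ D' := fun hvD' => hvD (Finset.mem_sdiff.mpr ⟨hvD', hvZ⟩)
      simp only [D', Finset.mem_filter, Finset.mem_univ, true_and, not_lt] at hvD'
      refine le_trans (Nat.mul_le_mul_left 2 (Finset.card_le_card fun h hh => ?_)) hvD'
      rw [Finset.mem_filter] at hh ⊢
      exact ⟨hh.1, hblocked h hh.1 v hh.2⟩)
  let g' : ℕ → V := fun x => if hx : x ∈ H then g ⟨x, hx⟩ else hV.some
  have hg' : ∀ x (hx : x ∈ H), g' x = g ⟨x, hx⟩ := fun x hx => dif_pos hx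
  obtain ⟨f, -, -, hf, hfree⟩ := exists_extend_isolated (Q := H) (g := g') hT hinj₂ hfree₂
    Finset.sdiff_disjoint (hfar _)
    (fun x hx y hy hxy => by
      rw [hg' x hx, hg' y hy] at hxy
      exact congrArg Subtype.val (hg hxy))
    (fun p hp q hq h => by
      rw [hg' q hq] at h
      exact (Finset.mem_sdiff.mp (hgS ⟨q, hq⟩).1).2 (h ▸ Finset.mem_image_of_mem f₂ hp))
    (fun q hq => by
      rw [hg' q hq]
      exact (hgS ⟨q, hq⟩).2)
  rw [Finset.sdiff_union_of_subset hHn] at hf hfree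
  exact ⟨f, hf, hfree⟩

/-- The ternary relation of a partial Mendelsohn triple system, closed under rotation. -/
def cyclicRel {V : Type} (M : Set (V × V × V)) (a b c : V) : Prop :=
  (a, b, c) ∈ M ∨ (b, c, a) ∈ M ∨ (c, a, b) ∈ M

theorem isCyclicPartial_cyclicRel {V : Type} {M : Set (V × V × V)}
    (hne : ∀ t ∈ M, t.1 ≠ t.2.1 ∧ t.1 ≠ t.2.2 ∧ t.2.1 ≠ t.2.2)
    (huniq : ∀ t ∈ M, ∀ t' ∈ M, ∀ p : V × V,
      p ∈ cycPairs t → p ∈ cycPairs t' → cycRot t t') : IsCyclicPartial (cyclicRel M) where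
  rotate := by
    unfold cyclicRel
    tauto
  ne := by
    rintro a b c (h | h | h)
    · exact (hne _ h).1
    · exact (hne _ h).2.1.symm
    · exact (hne _ h).2.2
  unique := by
    rintro a b c d h h'
    have hab : a ≠ b := by
      rcases h with h | h | h
      · exact (hne _ h).1
      · exact (hne _ h).2.1.symm
      · exact (hne _ h).2.2
    rcases h with h | h | h <;> rcases h' with h' | h' | h' <;>
      · have := huniq _ h _ h' (a, b) (by simp [cycPairs]) (by simp [cycPairs])
        simp only [cycRot, Prod.mk.injEq] at this
        grind

theorem exists_index_of_mem_take_drop {V : Type*} {f : ℕ → V} {n i m : ℕ} {v : V}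
    (h : v ∈ (((List.range n).map f).drop i).take m) :
    ∃ p, p < n ∧ i ≤ p ∧ p < i + m ∧ f p = v := by
  obtain ⟨k, hk, rfl⟩ := List.mem_iff_getElem.mp h
  simp only [List.length_take, List.length_drop, List.length_map, List.length_range] at hk
  exact ⟨i + k, by omega, by omega, by omega, by simp⟩

/-- there is a constant `C > 0` such that every partial Mendelsohn
triple system on `n ≥ ℓ⁴/2 + C·ℓ³` points has an `ℓ`-good (non-cyclic)
sequencing. -/
theorem stmt_5 :
    ∃ C : ℝ, 0 < C ∧ ∀ (ℓ n : ℕ), 0 < ℓ →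
      (n : ℝ) ≥ (ℓ : ℝ) ^ 4 / 2 + C * (ℓ : ℝ) ^ 3 →
      ∀ (V : Type) [Fintype V] [DecidableEq V], Fintype.card V = n →
      ∀ M : Set (V × V × V),
        (∀ t ∈ M, t.1 ≠ t.2.1 ∧ t.1 ≠ t.2.2 ∧ t.2.1 ≠ t.2.2) →
        (∀ t ∈ M, ∀ t' ∈ M, ∀ p : V × V,
          p ∈ cycPairs t → p ∈ cycPairs t' → cycRot t t') →
        ∃ xs : List V, xs.Nodup ∧ (∀ v : V, v ∈ xs) ∧
          ∀ i m : ℕ, m ≤ ℓ → ∀ t ∈ M,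
            ¬ List.Sublist [t.1, t.2.1, t.2.2] ((xs.drop i).take m) ∧
            ¬ List.Sublist [t.2.1, t.2.2, t.1] ((xs.drop i).take m) ∧
            ¬ List.Sublist [t.2.2, t.1, t.2.1] ((xs.drop i).take m) := by
  refine ⟨32, by norm_num, ?_⟩
  intro ℓ n hℓ hn V _ _ hV M hne huniq
  have hn' : 32 * ℓ ^ 3 ≤ Fintype.card V := by
    have h4 : (0 : ℝ) ≤ (ℓ : ℝ) ^ 4 / 2 := by positivity
    have : (32 * ℓ ^ 3 : ℝ) ≤ n := by linarith
    rw [hV]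
    exact_mod_cast this
  obtain ⟨f, hf, hfree⟩ :=
    exists_tripleFree (isCyclicPartial_cyclicRel hne huniq) hℓ hn'
  set N := Fintype.card V
  have havoid : ∀ i m, m ≤ ℓ → ∀ a b c, cyclicRel M a b c →
      ¬ List.Sublist [a, b, c] ((((List.range N).map f).drop i).take m) := by
    intro i m hm a b c ht hsub
    obtain ⟨p, hpn, hp1, hp2, rfl⟩ := exists_index_of_mem_take_drop (hsub.subset (by simp : a ∈ _))
    obtain ⟨q, hqn, hq1, hq2, rfl⟩ := exists_index_of_mem_take_drop (hsub.subset (by simp : b ∈ _))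
    obtain ⟨r, hrn, hr1, hr2, rfl⟩ := exists_index_of_mem_take_drop (hsub.subset (by simp : c ∈ _))
    exact hfree p (Finset.mem_range.mpr hpn) q (Finset.mem_range.mpr hqn) r
      (Finset.mem_range.mpr hrn) ⟨by omega, by omega⟩ ⟨by omega, by omega⟩
      ⟨by omega, by omega⟩ ht
  refine ⟨(List.range N).map f, ?_, ?_, fun i m hm t ht => ⟨?_, ?_, ?_⟩⟩
  · refine List.Nodup.map_on (fun x hx y hy hxy => hf ?_ ?_ hxy) List.nodup_range
    · simpa using hx
    · simpa using hy
  · have himage : (Finset.range N).image f = Finset.univ := by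
      rw [← Finset.card_eq_iff_eq_univ, Finset.card_image_of_injOn hf, Finset.card_range]
    intro v
    have hv := himage ▸ Finset.mem_univ v
    simpa using hv
  · exact havoid i m hm _ _ _ (Or.inl ht)
  · exact havoid i m hm _ _ _ (Or.inr (Or.inr ht))
  · exact havoid i m hm _ _ _ (Or.inr (Or.inl ht))
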